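/- On the question pair (x,y) = (2,4), the ideal correlation p* satisfies: p*(0,0|2,4) = 1/(1+α²) − (1−α²), p*(1,1|2,4) = α²/(1+α²), p*(2,0|2,4) = 1−α², and p*(a,b|2,4) = 0 for all other pairs (a,b) ∈ {0,1,2}×{0,1,2}. -/

import Mathlib

open Matrix Kronecker

noncomputable section

namespace Sep

/-- Pauli `σz`. -/
def sz : Matrix (Fin 2) (Fin 2) ℝ := !![1, 0; 0, -1]

/-- Pauli `σx`. -/
def sx : Matrix (Fin 2) (Fin 2) ℝ := !![0, 1; 1, 0]

/-- `μ = arctan (sin 2θ)` where `θ = arctan α`. -/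
def mu (α : ℝ) : ℝ := Real.arctan (Real.sin (2 * Real.arctan α))

/-- The tilted Pauli `σαz`. -/
def saz (α : ℝ) : Matrix (Fin 2) (Fin 2) ℝ :=
  Real.cos (mu α) • sz + Real.sin (mu α) • sx

/-- The tilted Pauli `σαx`. -/
def sax (α : ℝ) : Matrix (Fin 2) (Fin 2) ℝ :=
  Real.cos (mu α) • sz - Real.sin (mu α) • sx

/-- Orthogonal projection onto the `+1`-eigenspace of a symmetric involution `O`
(with eigenvalues `+1` and `-1`): `O⁺ = (I + O)/2`. -/
def pl (O : Matrix (Fin 2) (Fin 2) ℝ) : Matrix (Fin 2) (Fin 2) ℝ := (2 : ℝ)⁻¹ • (1 + O)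

/-- Orthogonal projection onto the `-1`-eigenspace: `O⁻ = (I - O)/2`. -/
def mn (O : Matrix (Fin 2) (Fin 2) ℝ) : Matrix (Fin 2) (Fin 2) ℝ := (2 : ℝ)⁻¹ • (1 - O)

/-- Embed a `2×2` matrix `O` as an `ℕ×ℕ` matrix supported on rows/columns `f 0, f 1`,
with entry `O r s` at position `(f r, f s)`. -/
def embed (f : Fin 2 → ℕ) (O : Matrix (Fin 2) (Fin 2) ℝ) : Matrix ℕ ℕ ℝ :=
  fun i j => ∑ r : Fin 2, ∑ s : Fin 2, if i = f r ∧ j = f s then O r s else 0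

/-- `ev_m(O)`: supported on `{2m, 2m+1}`. -/
def evm (m : ℕ) (O : Matrix (Fin 2) (Fin 2) ℝ) : Matrix ℕ ℕ ℝ :=
  embed (fun r => 2 * m + (r : ℕ)) O

/-- `od_m(O)`: supported on `{2m+1, 2m+2}`. -/
def odm (m : ℕ) (O : Matrix (Fin 2) (Fin 2) ℝ) : Matrix ℕ ℕ ℝ :=
  embed (fun r => 2 * m + 1 + (r : ℕ)) O

/-- Entrywise sum `Σ_m F m` of a family of `ℕ×ℕ` matrices. -/
def sumB (F : ℕ → Matrix ℕ ℕ ℝ) : Matrix ℕ ℕ ℝ := fun i j => ∑' m, F m i j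

/-- The `ℕ×ℕ` matrix with a single `1` entry at `(0,0)`. -/
def E00 : Matrix ℕ ℕ ℝ := fun i j => if i = 0 ∧ j = 0 then 1 else 0

/-- Alice's ideal operators `A_x^a`. -/
def Aop : Fin 4 → Fin 3 → Matrix ℕ ℕ ℝ :=
  ![![sumB (fun m => evm m (pl sz)), sumB (fun m => evm m (mn sz)), 0],
    ![sumB (fun m => evm m (pl sx)), sumB (fun m => evm m (mn sx)), 0],
    ![sumB (fun m => odm m (mn sz)), sumB (fun m => odm m (pl sz)), E00],
    ![sumB (fun m => odm m (mn sx)), sumB (fun m => odm m (pl sx)), E00]]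

/-- Bob's ideal operators `B_y^b`. -/
def Bop (α : ℝ) : Fin 5 → Fin 3 → Matrix ℕ ℕ ℝ :=
  ![![sumB (fun m => evm m (pl (saz α))), sumB (fun m => evm m (mn (saz α))), 0],
    ![sumB (fun m => evm m (pl (sax α))), sumB (fun m => evm m (mn (sax α))), 0],
    ![sumB (fun m => odm m (mn (saz α))), sumB (fun m => odm m (pl (saz α))), E00],
    ![sumB (fun m => odm m (mn (sax α))), sumB (fun m => odm m (pl (sax α))), E00],
    ![Aop 0 0, Aop 0 1, Aop 0 2]]

/-- The ideal correlation `p*(a,b|x,y) = (1-α²) Σ_{i,k} α^{i+k} A_x^a(i,k) B_y^b(i,k)`. -/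
def pstar (α : ℝ) (x : Fin 4) (y : Fin 5) (a b : Fin 3) : ℝ :=
  (1 - α ^ 2) * ∑' ik : ℕ × ℕ, α ^ (ik.1 + ik.2) * Aop x a ik.1 ik.2 * Bop α y b ik.1 ik.2

/-- A finite-dimensional strategy on question sets `Fin 4`, `Fin 5` and
answer sets `Fin 3`, `Fin 3`. -/
structure Strategy (dA dB : ℕ) where
  ψ : Fin dA × Fin dB → ℂ
  P : Fin 4 → Fin 3 → Matrix (Fin dA) (Fin dA) ℂ
  Q : Fin 5 → Fin 3 → Matrix (Fin dB) (Fin dB) ℂ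
  unit : ∑ p : Fin dA × Fin dB, Complex.normSq (ψ p) = 1
  P_sa : ∀ x a, (P x a)ᴴ = P x a
  P_proj : ∀ x a, P x a * P x a = P x a
  P_complete : ∀ x, ∑ a, P x a = 1
  Q_sa : ∀ y b, (Q y b)ᴴ = Q y b
  Q_proj : ∀ y b, Q y b * Q y b = Q y b
  Q_complete : ∀ y, ∑ b, Q y b = 1

/-- Action of `P ⊗ I` on a bipartite vector. -/
def actA {dA dB : ℕ} (P : Matrix (Fin dA) (Fin dA) ℂ) (ψ : Fin dA × Fin dB → ℂ) :
    Fin dA × Fin dB → ℂ := fun p => ∑ k, P p.1 k * ψ (k, p.2)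

/-- Action of `I ⊗ Q` on a bipartite vector. -/
def actB {dA dB : ℕ} (Q : Matrix (Fin dB) (Fin dB) ℂ) (ψ : Fin dA × Fin dB → ℂ) :
    Fin dA × Fin dB → ℂ := fun p => ∑ l, Q p.2 l * ψ (p.1, l)

/-- The correlation induced by a strategy: `⟨ψ, (P_x^a ⊗ Q_y^b) ψ⟩`. -/
def induced {dA dB : ℕ} (S : Strategy dA dB) (x : Fin 4) (y : Fin 5) (a b : Fin 3) : ℂ :=
  ∑ p : Fin dA × Fin dB, (starRingEnd ℂ) (S.ψ p) * actA (S.P x a) (actB (S.Q y b) S.ψ) p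

end Sep

namespace Sep

theorem pl_sz : pl sz = diagonal ![1, 0] := by
  ext r s; fin_cases r <;> fin_cases s <;> norm_num [pl, sz]

theorem mn_sz : mn sz = diagonal ![0, 1] := by
  ext r s; fin_cases r <;> fin_cases s <;> norm_num [mn, sz]

theorem embed_diagonal {f : Fin 2 → ℕ} (hf : f 0 ≠ f 1) (d : Fin 2 → ℝ) :
    embed f (diagonal d) =
      diagonal fun i => if i = f 0 then d 0 else if i = f 1 then d 1 else 0 := by
  ext i j
  simp only [embed, Fin.sum_univ_two, diagonal_apply]
  grind

theorem sumB_evm_diagonal (d : Fin 2 → ℝ) :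
    sumB (fun m => evm m (diagonal d)) = diagonal fun i => if Even i then d 0 else d 1 := by
  ext i j
  have h (m : ℕ) : evm m (diagonal d) i j = diagonal (fun i : ℕ =>
      if i = 2 * m then d 0 else if i = 2 * m + 1 then d 1 else 0) i j := by
    simp [evm, embed_diagonal]
  simp only [sumB, h, diagonal_apply]
  rw [tsum_eq_single (i / 2)] <;> grind

theorem sumB_odm_diagonal (d : Fin 2 → ℝ) :
    sumB (fun m => odm m (diagonal d)) =
      diagonal fun i => if i = 0 then 0 else if Even i then d 1 else d 0 := by
  ext i j
  have h (m : ℕ) : odm m (diagonal d) i j = diagonal (fun i : ℕ =>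
      if i = 2 * m + 1 then d 0 else if i = 2 * m + 2 then d 1 else 0) i j := by
    simp [odm, embed_diagonal]
  simp only [sumB, h, diagonal_apply]
  rw [tsum_eq_single ((i - 1) / 2)] <;> grind

theorem E00_eq_diagonal : E00 = diagonal fun i => if i = 0 then 1 else 0 := by
  ext i j
  simp only [E00, diagonal_apply]
  grind

theorem pstar_of_diagonal {α : ℝ} {x : Fin 4} {y : Fin 5} {a b : Fin 3} {d e : ℕ → ℝ}
    (hA : Aop x a = diagonal d) (hB : Bop α y b = diagonal e) :
    pstar α x y a b = (1 - α ^ 2) * ∑' i, (α ^ 2) ^ i * (d i * e i) := by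
  have hinj : Function.Injective fun i : ℕ => (i, i) := fun i j h => congrArg Prod.fst h
  rw [pstar, hA, hB, ← hinj.tsum_eq]
  · congr 1
    refine tsum_congr fun i => ?_
    simp only [diagonal_apply_eq]
    ring
  · rintro ⟨i, j⟩ h
    by_cases hij : i = j
    · exact ⟨i, by simp [hij]⟩
    · simp [hij] at h

theorem Aop_zero_zero : Aop 0 0 = diagonal fun i => if Even i then 1 else 0 := by
  simpa [Aop, pl_sz] using sumB_evm_diagonal ![1, 0]

theorem Aop_zero_one : Aop 0 1 = diagonal fun i => if Even i then 0 else 1 := by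
  simpa [Aop, mn_sz] using sumB_evm_diagonal ![0, 1]

theorem Aop_two_zero :
    Aop 2 0 = diagonal fun i => if i = 0 then 0 else if Even i then 1 else 0 := by
  simpa [Aop, mn_sz] using sumB_odm_diagonal ![0, 1]

theorem Aop_two_one :
    Aop 2 1 = diagonal fun i => if i = 0 then 0 else if Even i then 0 else 1 := by
  simpa [Aop, pl_sz] using sumB_odm_diagonal ![1, 0]

theorem Aop_two_two : Aop 2 2 = diagonal fun i => if i = 0 then 1 else 0 :=
  E00_eq_diagonal

theorem Bop_four (α : ℝ) (b : Fin 3) : Bop α 4 b = Aop 0 b := by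
  fin_cases b <;> simp [Bop]

theorem pstar_four_two (α : ℝ) (x : Fin 4) (a : Fin 3) : pstar α x 4 a 2 = 0 := by
  simp [pstar, Bop_four, Aop]

theorem tsum_arithmetic_geometric {r : ℝ} (h0 : 0 ≤ r) (h1 : r < 1) (c : ℕ) {f : ℕ → ℝ}
    (hf : ∀ i, f (2 * i + c) = 1) (hf' : ∀ i, (∀ j, i ≠ 2 * j + c) → f i = 0) :
    ∑' i, r ^ i * f i = r ^ c / (1 - r ^ 2) := by
  have hinj : Function.Injective fun j : ℕ => 2 * j + c := fun i j h => by grind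
  rw [← hinj.tsum_eq]
  · have h (j : ℕ) : r ^ (2 * j + c) * f (2 * j + c) = r ^ c * (r ^ 2) ^ j := by
      rw [hf]; ring
    simp only [h]
    rw [tsum_mul_left, tsum_geometric_of_lt_one (by positivity) (by nlinarith), div_eq_mul_inv]
  · intro i hi
    by_contra hn
    exact hi (by simp [hf' i fun j hj => hn ⟨j, hj.symm⟩])

end Sep

open Sep in
/-- the values of `p*` on the question pair `(x,y) = (2,4)`. -/
theorem pstar_24_values (α : ℝ) (hα0 : 0 < α) (hα1 : α < 1) :
    pstar α 2 4 0 0 = 1 / (1 + α ^ 2) - (1 - α ^ 2) ∧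
    pstar α 2 4 1 1 = α ^ 2 / (1 + α ^ 2) ∧
    pstar α 2 4 2 0 = 1 - α ^ 2 ∧
    (∀ a b : Fin 3, ¬((a = 0 ∧ b = 0) ∨ (a = 1 ∧ b = 1) ∨ (a = 2 ∧ b = 0)) →
      pstar α 2 4 a b = 0) := by
  have h0 : 0 ≤ α ^ 2 := by positivity
  have h1 : α ^ 2 < 1 := by nlinarith
  have hne : 1 - α ^ 2 ≠ 0 := by linarith
  have hne' : 1 + α ^ 2 ≠ 0 := by positivity
  have hfac : 1 - (α ^ 2) ^ 2 = (1 - α ^ 2) * (1 + α ^ 2) := by ring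
  refine ⟨?_, ?_, ?_, ?_⟩
  · rw [pstar_of_diagonal Aop_two_zero ((Bop_four α _).trans Aop_zero_zero),
      tsum_arithmetic_geometric h0 h1 2 ?_ ?_, hfac]
    · field_simp
      ring
    · grind
    · intro i hi
      have := hi ((i - 2) / 2)
      grind
  · rw [pstar_of_diagonal Aop_two_one ((Bop_four α _).trans Aop_zero_one),
      tsum_arithmetic_geometric h0 h1 1 ?_ ?_, hfac]
    · field_simp
    · grind
    · intro i hi
      have := hi ((i - 1) / 2)
      grind
  · rw [pstar_of_diagonal Aop_two_two ((Bop_four α _).trans Aop_zero_zero), tsum_eq_single 0]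
    · simp
    · intro i hi
      simp [hi]
  · have hz {a b : Fin 3} {d e : ℕ → ℝ} (hA : Aop 2 a = diagonal d)
        (hB : Bop α 4 b = diagonal e) (hde : ∀ i, d i * e i = 0) : pstar α 2 4 a b = 0 := by
      simp [pstar_of_diagonal hA hB, hde]
    intro a b hab
    fin_cases a <;> fin_cases b <;> simp at hab ⊢
    all_goals first
      | exact pstar_four_two ..
      | exact hz Aop_two_zero ((Bop_four α _).trans Aop_zero_one) (by grind)
      | exact hz Aop_two_one ((Bop_four α _).trans Aop_zero_zero) (by grind)
      | exact hz Aop_two_two ((Bop_four α _).trans Aop_zero_one) (by grind)
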